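/- arXiv:2010.08870 — 2 statements merged into one kernel-verified Lean document; each statement's English description precedes it below -/
import Mathlib

section
/- Almost-sure convergence of the estimated transition matrix at the ML estimate: let θ0 ∈ Θ, let μ be any initial distribution on {0,1}^p, and let θ̂_T be any sequence of maximum-likelihood estimators (for each T and each trajectory, θ̂_T maximizes θ ↦ ∑_{k=0}^{T−1} log p_{X(k)X(k+1)}(θ) over Θ). Then almost surely under P_{θ0,μ}, for every pair of states (u, v) ∈ ({0,1}^p)², |p_{uv}(θ̂_T) − p_{uv}(θ0)| → 0 as T → ∞. -/
open MeasureTheory Filter Matrix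

/-- The state space `{0,1}^p` of the BAR model, encoded as Boolean vectors. -/
abbrev State (p : ℕ) := Fin p → Bool

/-- The real vector in `{0,1}^p ⊆ ℝ^p` corresponding to a state. -/
noncomputable def stR {p : ℕ} (u : State p) : Fin p → ℝ := fun i => if u i then 1 else 0

/-- A parameter tuple `θ = (A, b, ρ_w)` of the BAR model with positive correlations. -/
abbrev Param (p : ℕ) := Matrix (Fin p) (Fin p) ℝ × (Fin p → ℝ) × (Fin p → ℝ)

/-- The parameter space `Θ` of the BAR model with positive correlations. -/
def barSpace (p : ℕ) (bmin ρmin ρmax : ℝ) : Set (Param p) :=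
  {θ | (∀ i j, 0 ≤ θ.1 i j) ∧ (∀ i, (∑ j, θ.1 i j) + θ.2.1 i = 1) ∧
       (∀ i, bmin ≤ θ.2.1 i) ∧ (∀ i, θ.2.2 i ∈ Set.Icc ρmin ρmax)}

/-- The Bernoulli parameter `a_i^⊤ u + b_i ρ_{w_i}` of node `i` given previous state `u`. -/
noncomputable def bern {p : ℕ} (θ : Param p) (u : State p) (i : Fin p) : ℝ :=
  (∑ j, θ.1 i j * stR u j) + θ.2.1 i * θ.2.2 i

/-- The BAR transition probability `p_{uv}(θ)`. -/
noncomputable def barTrans {p : ℕ} (θ : Param p) (u v : State p) : ℝ :=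
  ∏ i, if v i then bern θ u i else 1 - bern θ u i

/-- The log-likelihood `∑_{k=0}^{T-1} log p_{X(k)X(k+1)}(θ)` of a trajectory prefix. -/
noncomputable def logLik {p : ℕ} (θ : Param p) (T : ℕ) (ω : ℕ → State p) : ℝ :=
  ∑ k ∈ Finset.range T, Real.log (barTrans θ (ω k) (ω (k + 1)))

/-- `P` is the law of the BAR Markov chain with parameter `θ0` and initial distribution `μ`:
its finite-dimensional cylinder probabilities are the Markovian ones. -/
def IsBARLaw {p : ℕ} (θ0 : Param p) (μ : State p → ℝ)
    (P : Measure (ℕ → State p)) : Prop :=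
  ∀ (n : ℕ) (x : ℕ → State p),
    P {ω | ∀ k ≤ n, ω k = x k} =
      ENNReal.ofReal (μ (x 0) * ∏ k ∈ Finset.range n, barTrans θ0 (x k) (x (k + 1)))

/-- The paths that agree with `x` up to time `n`. -/
def pathCylinder {S : Type*} (n : ℕ) (x : ℕ → S) : Set (ℕ → S) := {ω | ∀ k ≤ n, ω k = x k}

section MarkovChain

lemma measurableSet_pathCylinder {S : Type*} [MeasurableSpace S] [MeasurableSingletonClass S]
    (n : ℕ) (x : ℕ → S) : MeasurableSet (pathCylinder n x) := by
  have : pathCylinder n x = ⋂ k, ⋂ (_ : k ≤ n), (fun ω : ℕ → S => ω k) ⁻¹' {x k} := by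
    ext ω; simp [pathCylinder]
  rw [this]
  exact MeasurableSet.iInter fun k => MeasurableSet.iInter fun _ =>
    measurable_pi_apply k (measurableSet_singleton _)

variable {S : Type*} [Fintype S] [MeasurableSpace S] [MeasurableSingletonClass S]
  {P : Measure (ℕ → S)} {Q : S → S → ℝ}

lemma measurable_step (g : S → S → ℝ) (k : ℕ) :
    Measurable fun ω : ℕ → S => g (ω k) (ω (k + 1)) :=
  Measurable.comp (f := fun ω : ℕ → S => (ω k, ω (k + 1)))
    (measurable_of_finite (Function.uncurry g))
    ((measurable_pi_apply k).prodMk (measurable_pi_apply (k + 1)))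

lemma measurable_sum_step (g : S → S → ℝ) (T : ℕ) :
    Measurable fun ω : ℕ → S => ∑ k ∈ Finset.range T, g (ω k) (ω (k + 1)) :=
  Finset.measurable_sum _ fun k _ => measurable_step g k

/-- An integral vanishes if it vanishes on all cylinders of a given length. -/
lemma integral_eq_zero_of_pathCylinder (n : ℕ) {h : (ℕ → S) → ℝ} (hint : Integrable h P)
    (h0 : ∀ x, ∫ ω in pathCylinder n x, h ω ∂P = 0) : ∫ ω, h ω ∂P = 0 := by
  let r : (ℕ → S) → (Finset.Iic n → S) := fun ω k => ω k
  have hr : Measurable r := measurable_pi_lambda _ fun k => measurable_pi_apply _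
  have hU : (⋃ y, r ⁻¹' {y}) = Set.univ := by ext ω; simp
  rw [← setIntegral_univ, ← hU, integral_iUnion_fintype]
  · refine Finset.sum_eq_zero fun y _ => ?_
    rcases (r ⁻¹' {y}).eq_empty_or_nonempty with he | ⟨x, hx⟩
    · simp [he]
    · have : r ⁻¹' {y} = pathCylinder n x := by
        ext ω
        simp only [Set.mem_preimage, Set.mem_singleton_iff] at hx ⊢
        rw [← hx, funext_iff]
        simp [r, pathCylinder]
      rw [this]; exact h0 x
  · exact fun y => hr (measurableSet_singleton y)
  · intro y z hyz
    exact Disjoint.preimage _ (by simpa using hyz)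
  · exact fun y => hint.integrableOn

lemma setIntegral_step_eq_zero [IsProbabilityMeasure P]
    (hP : ∀ n x, P.real (pathCylinder (n + 1) x) = P.real (pathCylinder n x) * Q (x n) (x (n + 1)))
    {g : S → S → ℝ} (hg : ∀ u, ∑ v, Q u v * g u v = 0) (n : ℕ) (x : ℕ → S) :
    ∫ ω in pathCylinder n x, g (ω n) (ω (n + 1)) ∂P = 0 := by
  classical
  have hm : ∀ v, MeasurableSet ((fun ω : ℕ → S => ω (n + 1)) ⁻¹' {v}) := fun v =>
    measurable_pi_apply _ (measurableSet_singleton v)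
  have h1 : ∫ ω in pathCylinder n x, g (ω n) (ω (n + 1)) ∂P =
      ∫ ω in pathCylinder n x,
        ∑ v, ((fun ω : ℕ → S => ω (n + 1)) ⁻¹' {v}).indicator (fun _ => g (x n) v) ω ∂P := by
    refine setIntegral_congr_fun (measurableSet_pathCylinder n x) fun ω hω => ?_
    classical
    rw [hω n le_rfl, Finset.sum_eq_single (ω (n + 1))]
    · simp
    · intro v _ hv
      exact Set.indicator_of_notMem (by simpa using hv.symm) _
    · simp
  rw [h1, integral_finsetSum _ fun v _ => (integrable_const _).indicator (hm v)]
  have h2 : ∀ v, (P.restrict (pathCylinder n x)).real ((fun ω : ℕ → S => ω (n + 1)) ⁻¹' {v}) =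
      P.real (pathCylinder n x) * Q (x n) v := by
    intro v
    have e : (fun ω : ℕ → S => ω (n + 1)) ⁻¹' {v} ∩ pathCylinder n x =
        pathCylinder (n + 1) (Function.update x (n + 1) v) := by
      ext ω
      simp only [pathCylinder, Set.mem_inter_iff, Set.mem_preimage, Set.mem_singleton_iff,
        Set.mem_ofPred_eq]
      constructor
      · rintro ⟨ha, hb⟩ k hk
        rcases eq_or_ne k (n + 1) with rfl | hne
        · simpa using ha
        · rw [Function.update_of_ne hne]; exact hb k (by omega)
      · intro h
        refine ⟨by simpa using h (n + 1) le_rfl, fun k hk => ?_⟩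
        have := h k (by omega)
        rwa [Function.update_of_ne (by omega)] at this
    have e' : pathCylinder n (Function.update x (n + 1) v) = pathCylinder n x := by
      ext ω
      refine forall₂_congr fun k hk => ?_
      rw [Function.update_of_ne (by omega)]
    rw [measureReal_restrict_apply (hm v), e, hP, e']
    simp
  simp_rw [integral_indicator_const _ (hm _), h2, smul_eq_mul, mul_assoc, ← Finset.mul_sum, hg,
    mul_zero]

lemma integral_sq_sum_step_le [IsProbabilityMeasure P]
    (hP : ∀ n x, P.real (pathCylinder (n + 1) x) = P.real (pathCylinder n x) * Q (x n) (x (n + 1)))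
    {g : S → S → ℝ} (hg : ∀ u, ∑ v, Q u v * g u v = 0) (hg1 : ∀ u v, |g u v| ≤ 1) (T : ℕ) :
    ∫ ω, (∑ k ∈ Finset.range T, g (ω k) (ω (k + 1))) ^ 2 ∂P ≤ T := by
  have hbd : ∀ T (ω : ℕ → S), |∑ k ∈ Finset.range T, g (ω k) (ω (k + 1))| ≤ T := fun T ω =>
    (Finset.abs_sum_le_sum_abs _ _).trans
      ((Finset.sum_le_sum fun k _ => hg1 _ _).trans (by simp))
  have i1 : ∀ T, Integrable
      (fun ω : ℕ → S => (∑ k ∈ Finset.range T, g (ω k) (ω (k + 1))) ^ 2) P := fun T =>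
    .of_bound ((measurable_sum_step g T).pow_const 2).aestronglyMeasurable ((T : ℝ) ^ 2)
      (.of_forall fun ω => by
        rw [norm_pow, Real.norm_eq_abs]; exact pow_le_pow_left₀ (abs_nonneg _) (hbd T ω) 2)
  have i2 : ∀ T, Integrable
      (fun ω : ℕ → S => (∑ k ∈ Finset.range T, g (ω k) (ω (k + 1))) * g (ω T) (ω (T + 1))) P :=
    fun T => .of_bound
      ((measurable_sum_step g T).mul (measurable_step g T)).aestronglyMeasurable ((T : ℝ) * 1)
      (.of_forall fun ω => by
        rw [norm_mul, Real.norm_eq_abs, Real.norm_eq_abs]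
        exact mul_le_mul (hbd T ω) (hg1 _ _) (abs_nonneg _) (by positivity))
  have hb2 : ∀ u v, g u v ^ 2 ≤ 1 := fun u v => (sq_le_one_iff_abs_le_one _).2 (hg1 u v)
  have i3 : ∀ T, Integrable (fun ω : ℕ → S => g (ω T) (ω (T + 1)) ^ 2) P := fun T =>
    .of_bound ((measurable_step g T).pow_const 2).aestronglyMeasurable 1
      (.of_forall fun ω => by
        rw [Real.norm_eq_abs, abs_of_nonneg (sq_nonneg _)]; exact hb2 _ _)
  induction T with
  | zero => simp
  | succ T ih =>
    have hz : ∫ ω, (∑ k ∈ Finset.range T, g (ω k) (ω (k + 1))) * g (ω T) (ω (T + 1)) ∂P = 0 := by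
      refine integral_eq_zero_of_pathCylinder T (i2 T) fun x => ?_
      rw [setIntegral_congr_fun (g := fun ω =>
        (∑ k ∈ Finset.range T, g (x k) (x (k + 1))) * g (ω T) (ω (T + 1)))
        (measurableSet_pathCylinder T x), integral_const_mul, setIntegral_step_eq_zero hP hg,
        mul_zero]
      intro ω hω
      refine congrArg (· * _) (Finset.sum_congr rfl fun k hk => ?_)
      have := Finset.mem_range.1 hk
      rw [hω k (by omega), hω (k + 1) (by omega)]
    have e : ∀ ω : ℕ → S, (∑ k ∈ Finset.range (T + 1), g (ω k) (ω (k + 1))) ^ 2 =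
        (∑ k ∈ Finset.range T, g (ω k) (ω (k + 1))) ^ 2 +
        2 * ((∑ k ∈ Finset.range T, g (ω k) (ω (k + 1))) * g (ω T) (ω (T + 1))) +
        g (ω T) (ω (T + 1)) ^ 2 := fun ω => by rw [Finset.sum_range_succ]; ring
    have h3 : ∫ ω, g (ω T) (ω (T + 1)) ^ 2 ∂P ≤ 1 :=
      (integral_mono (i3 T) (integrable_const 1) fun ω => hb2 _ _).trans (by simp)
    simp_rw [e]
    rw [integral_add (f := fun ω => _ + _) ((i1 T).add ((i2 T).const_mul 2)) (i3 T),
      integral_add (i1 T) ((i2 T).const_mul 2), integral_const_mul, hz]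
    push_cast
    linarith

/-- Nonnegative random variables with summable expectations tend to zero almost surely. -/
lemma ae_tendsto_zero_of_summable_integral {Ω : Type*} [MeasurableSpace Ω] {P : Measure Ω}
    {f : ℕ → Ω → ℝ} (hf : ∀ n, Integrable (f n) P) (h0 : ∀ n ω, 0 ≤ f n ω) {c : ℕ → ℝ}
    (hc : Summable c) (hfc : ∀ n, ∫ ω, f n ω ∂P ≤ c n) :
    ∀ᵐ ω ∂P, Tendsto (fun n => f n ω) atTop (nhds 0) := by
  have hm : ∀ n, AEMeasurable (fun ω => ENNReal.ofReal (f n ω)) P := fun n =>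
    (hf n).aemeasurable.ennreal_ofReal
  have hfin : ∫⁻ ω, ∑' n, ENNReal.ofReal (f n ω) ∂P ≠ ⊤ := by
    rw [lintegral_tsum hm]
    refine ne_top_of_le_ne_top hc.tsum_ofReal_ne_top (ENNReal.tsum_le_tsum fun n => ?_)
    rw [← ofReal_integral_eq_lintegral_ofReal (hf n) (.of_forall (h0 n))]
    exact ENNReal.ofReal_le_ofReal (hfc n)
  filter_upwards [ae_lt_top' (AEMeasurable.tsum hm) hfin] with ω hω
  have := (ENNReal.tendsto_toReal ENNReal.zero_ne_top).comp
    (ENNReal.tendsto_atTop_zero_of_tsum_ne_top hω.ne)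
  simpa [Function.comp_def, ENNReal.toReal_ofReal (h0 _ _)] using this

/-- Strong law for partial sums of bounded increments, from the subsequence of squares. -/
lemma tendsto_div_of_tendsto_sq {M : ℕ → ℝ} (hM : ∀ n, |M (n + 1) - M n| ≤ 1)
    (h : Tendsto (fun n : ℕ => (M (n ^ 2) / (n : ℝ) ^ 2) ^ 2) atTop (nhds 0)) :
    Tendsto (fun T : ℕ => M T / T) atTop (nhds 0) := by
  have hd : ∀ n d, |M (n + d) - M n| ≤ d := by
    intro n d
    induction d with
    | zero => simp
    | succ d ih =>
      have := abs_sub_le (M (n + (d + 1))) (M (n + d)) (M n)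
      have := hM (n + d)
      rw [add_assoc] at this
      push_cast
      linarith
  have h' : Tendsto (fun n : ℕ => |M (n ^ 2) / (n : ℝ) ^ 2| + 2 / (n : ℝ)) atTop (nhds 0) := by
    have a : Tendsto (fun n : ℕ => |M (n ^ 2) / (n : ℝ) ^ 2|) atTop (nhds 0) := by
      simpa [Real.sqrt_sq_eq_abs] using h.sqrt
    simpa using a.add (tendsto_const_div_atTop_nhds_zero_nat 2)
  have hs : Tendsto Nat.sqrt atTop atTop :=
    tendsto_atTop_atTop.2 fun b => ⟨b * b, fun a ha => Nat.le_sqrt.2 ha⟩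
  refine squeeze_zero_norm' ?_ (h'.comp hs)
  filter_upwards [eventually_ge_atTop 1] with T hT
  set n := Nat.sqrt T with hn
  have hn1 : 1 ≤ n := Nat.le_sqrt.2 (by simpa using hT)
  have hle : n ^ 2 ≤ T := Nat.sqrt_le' T
  have hle2 : T ≤ n ^ 2 + 2 * n := by have := Nat.sqrt_le_add T; rw [← hn] at this; nlinarith
  have h1 := hd (n ^ 2) (T - n ^ 2)
  rw [Nat.add_sub_cancel' hle] at h1
  have h2 : ((T - n ^ 2 : ℕ) : ℝ) ≤ 2 * n := by
    have : T - n ^ 2 ≤ 2 * n := by omega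
    exact_mod_cast this
  have h3 : |M T| ≤ |M (n ^ 2)| + 2 * n := by
    have := abs_sub_abs_le_abs_sub (M T) (M (n ^ 2)); linarith
  have hnpos : (0 : ℝ) < n := by exact_mod_cast hn1
  have hT' : (n : ℝ) ^ 2 ≤ T := by exact_mod_cast hle
  simp only [Function.comp_apply, Real.norm_eq_abs, abs_div, Nat.abs_cast, abs_pow]
  calc |M T| / T ≤ (|M (n ^ 2)| + 2 * n) / (n : ℝ) ^ 2 := by gcongr
    _ = _ := by rw [← hn]; field_simp

/-- Strong law of large numbers for centred functionals of the transitions of a Markov chain. -/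
lemma ae_tendsto_sum_step_div [IsProbabilityMeasure P]
    (hP : ∀ n x, P.real (pathCylinder (n + 1) x) = P.real (pathCylinder n x) * Q (x n) (x (n + 1)))
    {g : S → S → ℝ} (hg : ∀ u, ∑ v, Q u v * g u v = 0) (hg1 : ∀ u v, |g u v| ≤ 1) :
    ∀ᵐ ω ∂P, Tendsto (fun T : ℕ => (∑ k ∈ Finset.range T, g (ω k) (ω (k + 1))) / T)
      atTop (nhds 0) := by
  have key : ∀ᵐ ω ∂P, Tendsto (fun n : ℕ =>
      ((∑ k ∈ Finset.range (n ^ 2), g (ω k) (ω (k + 1))) / (n : ℝ) ^ 2) ^ 2) atTop (nhds 0) := by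
    refine ae_tendsto_zero_of_summable_integral (c := fun n : ℕ => 1 / (n : ℝ) ^ 2) ?_
      (fun n ω => sq_nonneg _) (Real.summable_one_div_nat_pow.2 one_lt_two) fun n => ?_
    · intro n
      refine .of_bound (((measurable_sum_step g _).div_const _).pow_const 2).aestronglyMeasurable
        1 (.of_forall fun ω => ?_)
      rw [Real.norm_eq_abs, abs_of_nonneg (sq_nonneg _), sq_le_one_iff_abs_le_one, abs_div,
        abs_of_nonneg (by positivity : (0 : ℝ) ≤ (n : ℝ) ^ 2)]
      refine div_le_one_of_le₀ ?_ (by positivity)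
      exact (Finset.abs_sum_le_sum_abs _ _).trans
        ((Finset.sum_le_sum fun k _ => hg1 _ _).trans (by simp))
    · simp_rw [div_pow]
      rw [integral_div]
      rcases Nat.eq_zero_or_pos n with rfl | hn
      · simp
      have := integral_sq_sum_step_le hP hg hg1 (n ^ 2)
      have hn' : (0 : ℝ) < n := by exact_mod_cast hn
      rw [div_le_div_iff₀ (by positivity) (by positivity)]
      push_cast at this
      nlinarith [sq_nonneg ((n : ℝ))]
  filter_upwards [key] with ω hω
  refine tendsto_div_of_tendsto_sq (M := fun T => ∑ k ∈ Finset.range T, g (ω k) (ω (k + 1)))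
    (fun n => ?_) hω
  simpa [Finset.sum_range_succ] using hg1 _ _

end MarkovChain

/-- The Kullback-Leibler divergence dominates the squared Hellinger distance. -/
lemma sum_sq_sqrt_sub_sqrt_le {S : Type*} [Fintype S] {q r : S → ℝ} (hq : ∀ v, 0 < q v)
    (hr : ∀ v, 0 < r v) (hq1 : ∑ v, q v = 1) (hr1 : ∑ v, r v = 1) :
    ∑ v, (√(r v) - √(q v)) ^ 2 ≤ -∑ v, q v * (Real.log (r v) - Real.log (q v)) := by
  have key : ∀ v, (√(r v) - √(q v)) ^ 2 ≤
      r v - q v - q v * (Real.log (r v) - Real.log (q v)) := by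
    intro v
    have h1 := Real.sqrt_pos.2 (hq v)
    have h2 := Real.sqrt_pos.2 (hr v)
    have hl := Real.log_le_sub_one_of_pos (div_pos h2 h1)
    rw [Real.log_div h2.ne' h1.ne', Real.log_sqrt (hq v).le, Real.log_sqrt (hr v).le] at hl
    have hm := mul_le_mul_of_nonneg_left hl (hq v).le
    have e : q v * (√(r v) / √(q v) - 1) = √(q v) * √(r v) - q v := by
      have := Real.mul_self_sqrt (hq v).le
      field_simp
      nlinarith
    rw [e] at hm
    have := Real.sq_sqrt (hq v).le
    have := Real.sq_sqrt (hr v).le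
    nlinarith
  refine (Finset.sum_le_sum fun v _ => key v).trans_eq ?_
  rw [Finset.sum_sub_distrib, Finset.sum_sub_distrib, hq1, hr1]
  ring

/-- Along a path whose transition frequencies match `Q`, transition matrices that are at least as
likely as `Q` converge to `Q`. -/
lemma tendsto_of_logLik_le {S : Type*} [Fintype S] [DecidableEq S] {Q : S → S → ℝ}
    {R : ℕ → S → S → ℝ} {ε : ℝ} (hε : 0 < ε) (hQε : ∀ u v, ε ≤ Q u v)
    (hRε : ∀ T u v, ε ≤ R T u v) (hQ1 : ∀ u, ∑ v, Q u v = 1) (hR1 : ∀ T u, ∑ v, R T u v = 1)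
    (x : ℕ → S)
    (hlik : ∀ T, ∑ k ∈ Finset.range T, Real.log (Q (x k) (x (k + 1))) ≤
      ∑ k ∈ Finset.range T, Real.log (R T (x k) (x (k + 1))))
    (htrans : ∀ u v, Tendsto (fun T : ℕ => (∑ k ∈ Finset.range T,
      (if x k = u then (if x (k + 1) = v then 1 else 0) - Q u v else 0)) / T) atTop (nhds 0))
    (hvisit : ∀ v, Tendsto (fun T : ℕ => (∑ k ∈ Finset.range T,
      ((if x (k + 1) = v then 1 else 0) - Q (x k) v)) / T) atTop (nhds 0)) (u v : S) :
    Tendsto (fun T => R T u v) atTop (nhds (Q u v)) := by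
  set M : ℕ → S → S → ℝ := fun T u v => ∑ k ∈ Finset.range T,
      (if x k = u then (if x (k + 1) = v then 1 else 0) - Q u v else 0) with hM
  have hQ0 : ∀ u v, 0 < Q u v := fun u v => hε.trans_le (hQε u v)
  have hR0 : ∀ T u v, 0 < R T u v := fun T u v => hε.trans_le (hRε T u v)
  have hQle : ∀ u v, Q u v ≤ 1 := fun u v => hQ1 u ▸
    Finset.single_le_sum (fun v _ => (hQ0 u v).le) (Finset.mem_univ v)
  have hRle : ∀ T u v, R T u v ≤ 1 := fun T u v => hR1 T u ▸
    Finset.single_le_sum (fun v _ => (hR0 T u v).le) (Finset.mem_univ v)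
  set l : ℕ → S → S → ℝ := fun T a b => Real.log (R T a b) - Real.log (Q a b) with hl
  set K : ℕ → S → ℝ := fun T a => -∑ b, Q a b * l T a b with hK
  have hlC : ∀ T a b, |l T a b| ≤ -Real.log ε := by
    intro T a b
    have := Real.log_le_log hε (hQε a b)
    have := Real.log_le_log hε (hRε T a b)
    have := Real.log_nonpos (hQ0 a b).le (hQle a b)
    have := Real.log_nonpos (hR0 T a b).le (hRle T a b)
    rw [abs_le]; constructor <;> simp only [hl] <;> linarith
  have hKH : ∀ T a, ∑ b, (√(R T a b) - √(Q a b)) ^ 2 ≤ K T a := fun T a =>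
    sum_sq_sqrt_sub_sqrt_le (hQ0 a) (hR0 T a) (hQ1 a) (hR1 T a)
  have hK0 : ∀ T a, 0 ≤ K T a := fun T a =>
    (Finset.sum_nonneg fun b _ => sq_nonneg _).trans (hKH T a)
  have hid : ∀ T, ∑ a, ∑ b, l T a b * M T a b =
      ∑ k ∈ Finset.range T, l T (x k) (x (k + 1)) + ∑ k ∈ Finset.range T, K T (x k) := by
    intro T
    simp_rw [hM, Finset.mul_sum]
    rw [← Finset.sum_add_distrib]
    simp_rw [fun a => Finset.sum_comm (s := (Finset.univ : Finset S)) (t := Finset.range T)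
      (f := fun b k => l T a b * (if x k = a then (if x (k + 1) = b then 1 else 0) - Q a b else 0))]
    rw [Finset.sum_comm]
    refine Finset.sum_congr rfl fun k _ => ?_
    rw [Finset.sum_eq_single (x k) (fun a _ ha => by simp [ha.symm]) (by simp)]
    simp only [hK, if_true, mul_sub, Finset.sum_sub_distrib, mul_comm (Q _ _)]
    simp [sub_eq_add_neg]
  have hKM : ∀ T, ∑ k ∈ Finset.range T, K T (x k) ≤ -Real.log ε * ∑ a, ∑ b, |M T a b| := by
    intro T
    have h1 : 0 ≤ ∑ k ∈ Finset.range T, l T (x k) (x (k + 1)) := by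
      have := hlik T
      simp only [hl, Finset.sum_sub_distrib]
      linarith
    have h2 : ∑ a, ∑ b, l T a b * M T a b ≤ -Real.log ε * ∑ a, ∑ b, |M T a b| := by
      simp_rw [Finset.mul_sum]
      refine Finset.sum_le_sum fun a _ => Finset.sum_le_sum fun b _ => ?_
      refine (le_abs_self _).trans ?_
      rw [abs_mul]
      exact mul_le_mul_of_nonneg_right (hlC T a b) (abs_nonneg _)
    linarith [hid T]
  have hN : ∀ T : ℕ, ε * T + (∑ k ∈ Finset.range T,
      ((if x (k + 1) = u then (1 : ℝ) else 0) - Q (x k) u)) - 1 ≤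
      ∑ k ∈ Finset.range T, (if x k = u then (1 : ℝ) else 0) := by
    intro T
    have h1 := Finset.sum_range_succ (fun k => if x k = u then (1 : ℝ) else 0) T
    rw [Finset.sum_range_succ'] at h1
    have h2 : ε * T ≤ ∑ k ∈ Finset.range T, Q (x k) u := by
      have := Finset.card_nsmul_le_sum (Finset.range T) (fun k => Q (x k) u) ε fun k _ => hQε _ _
      simpa [mul_comm] using this
    have h3 : (if x T = u then (1 : ℝ) else 0) ≤ 1 := by split_ifs <;> norm_num
    have h4 : (0 : ℝ) ≤ if x 0 = u then (1 : ℝ) else 0 := by split_ifs <;> norm_num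
    rw [Finset.sum_sub_distrib]
    linarith
  have hNev : ∀ᶠ T : ℕ in atTop,
      ε / 2 * T ≤ ∑ k ∈ Finset.range T, (if x k = u then (1 : ℝ) else 0) := by
    have h1 := (hvisit u).sub (tendsto_const_div_atTop_nhds_zero_nat (1 : ℝ))
    filter_upwards [h1.eventually_const_lt (show -(ε / 2) < 0 - 0 by linarith),
      eventually_ge_atTop 1] with T hT hT1
    have hTpos : (0 : ℝ) < T := by exact_mod_cast hT1
    rw [← sub_div, lt_div_iff₀ hTpos] at hT
    linarith [hN T]
  have hbound : ∀ T, (√(R T u v) - √(Q u v)) ^ 2 *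
      ∑ k ∈ Finset.range T, (if x k = u then (1 : ℝ) else 0) ≤
      -Real.log ε * ∑ a, ∑ b, |M T a b| := by
    intro T
    refine le_trans ?_ (hKM T)
    rw [Finset.mul_sum]
    refine Finset.sum_le_sum fun k _ => ?_
    split_ifs with h
    · rw [h, mul_one]
      exact (Finset.single_le_sum (f := fun b => (√(R T u b) - √(Q u b)) ^ 2)
        (fun b _ => sq_nonneg _) (Finset.mem_univ v)).trans (hKH T u)
    · simpa using hK0 T _
  have hlim : Tendsto (fun T : ℕ => 2 / ε * (-Real.log ε * ∑ a, ∑ b, |M T a b / T|)) atTop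
      (nhds 0) := by
    have : Tendsto (fun T : ℕ => ∑ a, ∑ b, |M T a b / T|) atTop
        (nhds (∑ _a : S, ∑ _b : S, |(0 : ℝ)|)) :=
      tendsto_finsetSum _ fun a _ => tendsto_finsetSum _ fun b _ => (htrans a b).abs
    simpa using (this.const_mul (-Real.log ε)).const_mul (2 / ε)
  have hsq : Tendsto (fun T => (√(R T u v) - √(Q u v)) ^ 2) atTop (nhds 0) := by
    refine squeeze_zero' (.of_forall fun T => sq_nonneg _) ?_ hlim
    filter_upwards [hNev, eventually_ge_atTop 1] with T hT hT1
    have hTpos : (0 : ℝ) < T := by exact_mod_cast hT1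
    have h1 := (mul_le_mul_of_nonneg_left hT (sq_nonneg (√(R T u v) - √(Q u v)))).trans (hbound T)
    simp_rw [abs_div, Nat.abs_cast, ← Finset.sum_div]
    rw [← mul_div_assoc, ← mul_div_assoc, le_div_iff₀ hTpos, div_mul_eq_mul_div, le_div_iff₀ hε]
    linarith
  have habs : Tendsto (fun T => √(R T u v) - √(Q u v)) atTop (nhds 0) := by
    refine (tendsto_zero_iff_abs_tendsto_zero _).2 ?_
    simpa [Real.sqrt_sq_eq_abs, Function.comp_def] using hsq.sqrt
  have hfin := (habs.add_const √(Q u v)).pow 2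
  simpa [Real.sq_sqrt (hQ0 u v).le, Real.sq_sqrt (hR0 _ u v).le] using hfin

lemma bern_mem_Icc {p : ℕ} {bmin ρmin ρmax : ℝ} (hb : 0 < bmin) (hρmin : 0 < ρmin)
    (hρmax : ρmax < 1) {θ : Param p} (hθ : θ ∈ barSpace p bmin ρmin ρmax) (u : State p)
    (i : Fin p) : bern θ u i ∈ Set.Icc (bmin * ρmin) (1 - bmin * (1 - ρmax)) := by
  obtain ⟨hA, hsum, hbi, hρi⟩ := hθ
  have h0 : 0 ≤ ∑ j, θ.1 i j * stR u j := Finset.sum_nonneg fun j _ =>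
    mul_nonneg (hA i j) (by unfold stR; split_ifs <;> norm_num)
  have h1 : ∑ j, θ.1 i j * stR u j ≤ ∑ j, θ.1 i j := Finset.sum_le_sum fun j _ =>
    mul_le_of_le_one_right (hA i j) (by unfold stR; split_ifs <;> norm_num)
  have h2 : bmin * ρmin ≤ θ.2.1 i * θ.2.2 i :=
    mul_le_mul (hbi i) (hρi i).1 hρmin.le (hb.le.trans (hbi i))
  have h3 : bmin * (1 - ρmax) ≤ θ.2.1 i * (1 - θ.2.2 i) :=
    mul_le_mul (hbi i) (by linarith [(hρi i).2]) (by linarith) (hb.le.trans (hbi i))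
  have h4 := hsum i
  unfold bern
  constructor <;> nlinarith

lemma exists_pos_le_barTrans (p : ℕ) {bmin ρmin ρmax : ℝ} (hb : 0 < bmin) (hρmin : 0 < ρmin)
    (hρmax : ρmax < 1) :
    ∃ ε > 0, ∀ θ ∈ barSpace p bmin ρmin ρmax, ∀ u v, ε ≤ barTrans θ u v := by
  have hδ : 0 < min (bmin * ρmin) (bmin * (1 - ρmax)) :=
    lt_min (mul_pos hb hρmin) (mul_pos hb (by linarith))
  refine ⟨min (bmin * ρmin) (bmin * (1 - ρmax)) ^ p, pow_pos hδ p, fun θ hθ u v => ?_⟩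
  have hprod := Finset.prod_le_prod (s := (Finset.univ : Finset (Fin p)))
    (f := fun _ => min (bmin * ρmin) (bmin * (1 - ρmax)))
    (g := fun i => if v i then bern θ u i else 1 - bern θ u i) (fun _ _ => hδ.le) fun i _ => by
      have := bern_mem_Icc hb hρmin hρmax hθ u i
      split_ifs
      · exact (min_le_left _ _).trans this.1
      · exact (min_le_right _ _).trans (by linarith [this.2])
  simpa [barTrans] using hprod

lemma sum_barTrans {p : ℕ} (θ : Param p) (u : State p) : ∑ v, barTrans θ u v = 1 := by
  unfold barTrans
  rw [← Fintype.prod_sum fun i (b : Bool) => if b then bern θ u i else 1 - bern θ u i]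
  simp

lemma IsBARLaw.real_pathCylinder_succ {p : ℕ} {θ0 : Param p} {μ : State p → ℝ}
    {P : Measure (ℕ → State p)} (hP : IsBARLaw θ0 μ P) (hμ : ∀ u, 0 ≤ μ u)
    (h0 : ∀ u v, 0 ≤ barTrans θ0 u v) (n : ℕ) (x : ℕ → State p) :
    P.real (pathCylinder (n + 1) x) =
      P.real (pathCylinder n x) * barTrans θ0 (x n) (x (n + 1)) := by
  have h : ∀ m, P.real (pathCylinder m x) =
      μ (x 0) * ∏ k ∈ Finset.range m, barTrans θ0 (x k) (x (k + 1)) := fun m => by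
    rw [measureReal_def, pathCylinder, hP m x,
      ENNReal.toReal_ofReal (mul_nonneg (hμ _) (Finset.prod_nonneg fun k _ => h0 _ _))]
  rw [h, h, Finset.prod_range_succ, mul_assoc]

/-- **Almost-sure convergence of the estimated transition matrix at the ML estimate.**
For any sequence of maximum-likelihood estimators `θhat T`, almost surely under `P_{θ0,μ}`,
`|p_{uv}(θhat T) − p_{uv}(θ0)| → 0` for every pair of states `(u, v)`. -/
theorem mle_transition_convergence
    (p : ℕ) (hp : 1 ≤ p) (bmin ρmin ρmax : ℝ)
    (hbmin : bmin ∈ Set.Ioo (0 : ℝ) 1)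
    (hρmin : 0 < ρmin) (hρ : ρmin ≤ ρmax) (hρmax : ρmax < 1)
    (θ0 : Param p) (hθ0 : θ0 ∈ barSpace p bmin ρmin ρmax)
    (μ : State p → ℝ) (hμ0 : ∀ u, 0 ≤ μ u) (hμ1 : ∑ u, μ u = 1)
    (P : Measure (ℕ → State p)) (hPprob : IsProbabilityMeasure P)
    (hPlaw : IsBARLaw θ0 μ P)
    (θhat : ℕ → (ℕ → State p) → Param p)
    (hmem : ∀ T ω, θhat T ω ∈ barSpace p bmin ρmin ρmax)
    (hmax : ∀ T ω, ∀ θ ∈ barSpace p bmin ρmin ρmax, logLik θ T ω ≤ logLik (θhat T ω) T ω) :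
    ∀ᵐ ω ∂P, ∀ u v : State p,
      Tendsto (fun T => |barTrans (θhat T ω) u v - barTrans θ0 u v|) atTop (nhds 0) := by
  obtain ⟨ε, hε, hlow⟩ := exists_pos_le_barTrans p hbmin.1 hρmin hρmax
  have hQ0 : ∀ u v, 0 ≤ barTrans θ0 u v := fun u v => hε.le.trans (hlow θ0 hθ0 u v)
  have hQ1 : ∀ u v, barTrans θ0 u v ≤ 1 := fun u v => sum_barTrans θ0 u ▸
    Finset.single_le_sum (fun v _ => hQ0 u v) (Finset.mem_univ v)
  have hcyl := hPlaw.real_pathCylinder_succ hμ0 hQ0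
  have hcentred : ∀ u v, ∑ b, barTrans θ0 u b * ((if b = v then 1 else 0) - barTrans θ0 u v) = 0 :=
    fun u v => by
      simp [mul_sub, Finset.sum_sub_distrib, ← Finset.sum_mul, sum_barTrans]
  have hbdd : ∀ u v b, |(if b = v then (1 : ℝ) else 0) - barTrans θ0 u v| ≤ 1 := fun u v b => by
    have := hQ0 u v
    have := hQ1 u v
    rw [abs_le]
    split_ifs <;> constructor <;> linarith
  have htrans : ∀ᵐ ω ∂P, ∀ u v, Tendsto (fun T : ℕ => (∑ k ∈ Finset.range T,
      (if ω k = u then (if ω (k + 1) = v then 1 else 0) - barTrans θ0 u v else 0)) / (T : ℝ))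
      atTop (nhds 0) := by
    refine ae_all_iff.2 fun u => ae_all_iff.2 fun v => ae_tendsto_sum_step_div hcyl
      (g := fun a b => if a = u then (if b = v then 1 else 0) - barTrans θ0 u v else 0)
      (fun a => ?_) fun a b => ?_
    · by_cases h : a = u
      · simpa [h] using hcentred u v
      · simp [h]
    · by_cases h : a = u
      · simpa [h] using hbdd u v b
      · simp [h]
  have hvisit : ∀ᵐ ω ∂P, ∀ v, Tendsto (fun T : ℕ => (∑ k ∈ Finset.range T,
      ((if ω (k + 1) = v then 1 else 0) - barTrans θ0 (ω k) v)) / (T : ℝ)) atTop (nhds 0) :=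
    ae_all_iff.2 fun v => ae_tendsto_sum_step_div hcyl
      (g := fun a b => (if b = v then 1 else 0) - barTrans θ0 a v)
      (fun a => hcentred a v) fun a b => hbdd a v b
  filter_upwards [htrans, hvisit] with ω h1 h2 u v
  have hconv := tendsto_of_logLik_le hε (hlow θ0 hθ0) (fun T => hlow _ (hmem T ω))
    (sum_barTrans θ0) (fun T => sum_barTrans (θhat T ω)) ω (fun T => hmax T ω θ0 hθ0) h1 h2 u v
  simpa using (hconv.sub_const (barTrans θ0 u v)).abs
end

section
/- Strong consistency of the maximum-likelihood estimator for the generic BAR model: let θ̃0 = (A, Ã, b, ρ_w) ∈ Θ̃ and let μ be any initial distribution on {0,1}^p. Then for any sequence of maximum-likelihood estimators θ̃_T (i.e., for each T and each trajectory, θ̃_T is a maximizer over Θ̃ of θ̃ ↦ ∑_{k=0}^{T−1} log p_{X(k)X(k+1)}(θ̃)), one has θ̃_T → θ̃0 almost surely under P_{θ̃0,μ} as T → ∞. -/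
open MeasureTheory Filter Matrix

/-- A parameter tuple `θ̃ = (A, Ã, b, ρ_w)` of the generic BAR model. -/
abbrev GParam (p : ℕ) :=
  Matrix (Fin p) (Fin p) ℝ × Matrix (Fin p) (Fin p) ℝ × (Fin p → ℝ) × (Fin p → ℝ)

/-- The parameter space `Θ̃` of the generic BAR model. -/
def gBarSpace (p : ℕ) (bmin ρmin ρmax : ℝ) : Set (GParam p) :=
  {θ | (∀ i j, 0 ≤ θ.1 i j) ∧ (∀ i j, 0 ≤ θ.2.1 i j) ∧
       (∀ i j, θ.1 i j * θ.2.1 i j = 0) ∧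
       (∀ i, (∑ j, (θ.1 i j + θ.2.1 i j)) + θ.2.2.1 i = 1) ∧
       (∀ i, bmin ≤ θ.2.2.1 i) ∧ (∀ i, θ.2.2.2 i ∈ Set.Icc ρmin ρmax)}

/-- The Bernoulli parameter `a_i^⊤ u + ã_i^⊤ (1_p − u) + b_i ρ_{w_i}` of node `i`
given previous state `u`, for the generic BAR model. -/
noncomputable def gBern {p : ℕ} (θ : GParam p) (u : State p) (i : Fin p) : ℝ :=
  (∑ j, θ.1 i j * stR u j) + (∑ j, θ.2.1 i j * (1 - stR u j)) + θ.2.2.1 i * θ.2.2.2 i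

/-- The generic BAR transition probability `p_{uv}(θ̃)`. -/
noncomputable def gBarTrans {p : ℕ} (θ : GParam p) (u v : State p) : ℝ :=
  ∏ i, if v i then gBern θ u i else 1 - gBern θ u i

/-- The log-likelihood `∑_{k=0}^{T-1} log p_{X(k)X(k+1)}(θ̃)` of a trajectory prefix. -/
noncomputable def gLogLik {p : ℕ} (θ : GParam p) (T : ℕ) (ω : ℕ → State p) : ℝ :=
  ∑ k ∈ Finset.range T, Real.log (gBarTrans θ (ω k) (ω (k + 1)))

/-- `P` is the law of the generic BAR Markov chain with parameter `θ0` and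
initial distribution `μ`. -/
def IsGBARLaw {p : ℕ} (θ0 : GParam p) (μ : State p → ℝ)
    (P : Measure (ℕ → State p)) : Prop :=
  ∀ (n : ℕ) (x : ℕ → State p),
    P {ω | ∀ k ≤ n, ω k = x k} =
      ENNReal.ofReal (μ (x 0) * ∏ k ∈ Finset.range n, gBarTrans θ0 (x k) (x (k + 1)))
/-- Bounded increments allow passing from the subsequence of squares to the full sequence. -/
theorem tendsto_div_of_tendsto_sq_div {s : ℕ → ℝ} (hs : ∀ n, |s (n + 1) - s n| ≤ 1)
    (h : Tendsto (fun n : ℕ => s (n ^ 2) / (n : ℝ) ^ 2) atTop (nhds 0)) :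
    Tendsto (fun n : ℕ => s n / n) atTop (nhds 0) := by
  have hlip : ∀ m d : ℕ, |s (m + d) - s m| ≤ d := by
    intro m d
    induction d with
    | zero => simp
    | succ d ih =>
      have h1 := abs_add_le (s (m + d + 1) - s (m + d)) (s (m + d) - s m)
      rw [sub_add_sub_cancel] at h1
      push_cast
      rw [← add_assoc]
      linarith [hs (m + d)]
  have hsqrt : Tendsto Nat.sqrt atTop atTop := by
    refine tendsto_atTop.2 fun b => ?_
    filter_upwards [eventually_ge_atTop (b * b)] with n hn
    exact Nat.le_sqrt.2 hn
  have hlim : Tendsto (fun n : ℕ => |s (n ^ 2) / (n : ℝ) ^ 2| + 2 * ((n : ℝ))⁻¹) atTop (nhds 0) := by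
    simpa using h.abs.add (tendsto_inv_atTop_nhds_zero_nat (𝕜 := ℝ) |>.const_mul 2)
  refine squeeze_zero_norm' ?_ (hlim.comp hsqrt)
  filter_upwards [eventually_ge_atTop 1] with n hn
  set r := n.sqrt with hr
  have hr1 : 1 ≤ r := Nat.le_sqrt.2 (by simpa using hn)
  obtain ⟨d, hd⟩ := Nat.exists_eq_add_of_le (show r ^ 2 ≤ n from Nat.sqrt_le' n)
  have hd2 : d ≤ 2 * r := by
    have := Nat.sqrt_le_add n
    rw [← hr] at this
    nlinarith
  have hr0 : (0 : ℝ) < r := by exact_mod_cast hr1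
  have hrn : (r : ℝ) ^ 2 ≤ n := by exact_mod_cast Nat.sqrt_le' n
  have hdr : (d : ℝ) ≤ 2 * r := by exact_mod_cast hd2
  have hb : |s n| ≤ |s (r ^ 2)| + 2 * r := by
    have h1 := hlip (r ^ 2) d
    rw [← hd] at h1
    have h2 := abs_sub_abs_le_abs_sub (s n) (s (r ^ 2))
    linarith
  simp only [Function.comp, Real.norm_eq_abs, abs_div, Nat.abs_cast, abs_pow]
  calc |s n| / n ≤ (|s (r ^ 2)| + 2 * r) / (r : ℝ) ^ 2 := by gcongr
    _ = |s (r ^ 2)| / (r : ℝ) ^ 2 + 2 * (r : ℝ)⁻¹ := by rw [add_div]; congr 1; field_simp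

/-- A strong law of large numbers for sequences bounded by `1`, each term of which is orthogonal
to the sum of the previous ones. -/
theorem ae_tendsto_sum_div_of_orthogonal {Ω : Type*} [MeasurableSpace Ω] (P : Measure Ω)
    [IsProbabilityMeasure P] (D : ℕ → Ω → ℝ) (hD : ∀ k, Measurable (D k))
    (hb : ∀ k ω, |D k ω| ≤ 1)
    (horth : ∀ n, ∫ ω, (∑ k ∈ Finset.range n, D k ω) * D n ω ∂P = 0) :
    ∀ᵐ ω ∂P, Tendsto (fun n : ℕ => (∑ k ∈ Finset.range n, D k ω) / n) atTop (nhds 0) := by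
  set S : ℕ → Ω → ℝ := fun n ω => ∑ k ∈ Finset.range n, D k ω with hS
  have hSm : ∀ n, Measurable (S n) := fun n => Finset.measurable_fun_sum _ fun k _ => hD k
  have hSb : ∀ n ω, |S n ω| ≤ n := fun n ω =>
    (Finset.abs_sum_le_sum_abs _ _).trans <|
      (Finset.sum_le_sum fun k _ => hb k ω).trans (by simp)
  have hinteg : ∀ {f : Ω → ℝ} (c : ℝ), Measurable f → (∀ ω, |f ω| ≤ c) → Integrable f P :=
    fun c hf hc => Integrable.of_bound hf.aestronglyMeasurable c (ae_of_all _ hc)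
  have hSsq : ∀ n, Integrable (fun ω => S n ω ^ 2) P := fun n =>
    hinteg ((n : ℝ) ^ 2) ((hSm n).pow_const 2) fun ω => by
      rw [abs_pow]; gcongr; exact hSb n ω
  have hmoment : ∀ n, ∫ ω, S n ω ^ 2 ∂P ≤ n := by
    intro n
    induction n with
    | zero => simp [hS]
    | succ n ih =>
      have e : ∀ ω, S (n + 1) ω ^ 2 = S n ω ^ 2 + 2 * (S n ω * D n ω) + D n ω ^ 2 := fun ω => by
        simp only [hS, Finset.sum_range_succ]; ring
      have i1 : Integrable (fun ω => S n ω * D n ω) P :=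
        hinteg ((n : ℝ) * 1) ((hSm n).mul (hD n)) fun ω => by
          rw [abs_mul]; gcongr
          · exact hSb n ω
          · exact hb n ω
      have hd1 : ∀ ω, D n ω ^ 2 ≤ 1 := fun ω => (sq_le_one_iff_abs_le_one _).2 (hb n ω)
      have i2 : Integrable (fun ω => D n ω ^ 2) P :=
        hinteg 1 ((hD n).pow_const 2) fun ω => by
          rw [abs_of_nonneg (sq_nonneg _)]; exact hd1 ω
      have h2 : ∫ ω, D n ω ^ 2 ∂P ≤ 1 := by
        simpa using integral_mono i2 (integrable_const (1 : ℝ)) hd1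
      simp_rw [e]
      have i3 : Integrable (fun ω => S n ω ^ 2 + 2 * (S n ω * D n ω)) P :=
        (hSsq n).add (i1.const_mul 2)
      rw [integral_add i3 i2, integral_add (hSsq n) (i1.const_mul 2),
        integral_const_mul, horth n]
      push_cast
      linarith
  have hsub : ∀ᵐ ω ∂P, Tendsto (fun n : ℕ => S (n ^ 2) ω / (n : ℝ) ^ 2) atTop (nhds 0) := by
    set F : ℕ → Ω → ℝ := fun n ω => (S (n ^ 2) ω / (n : ℝ) ^ 2) ^ 2 with hF
    have hFm : ∀ n, Measurable (F n) := fun n => ((hSm _).div_const _).pow_const 2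
    have hFi : ∀ n, ∫ ω, F n ω ∂P ≤ 1 / (n : ℝ) ^ 2 := by
      intro n
      simp only [hF, div_pow]
      rw [integral_div]
      rcases Nat.eq_zero_or_pos n with rfl | hn
      · simp
      · have hn' : (0 : ℝ) < n := by exact_mod_cast hn
        have := hmoment (n ^ 2)
        push_cast at this
        calc _ ≤ (n : ℝ) ^ 2 / ((n : ℝ) ^ 2) ^ 2 := by gcongr
          _ = _ := by field_simp
    have hfin : ∫⁻ ω, ∑' n, ENNReal.ofReal (F n ω) ∂P ≠ ⊤ := by
      rw [lintegral_tsum fun n => (hFm n).ennreal_ofReal.aemeasurable]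
      have hle : ∀ n, ∫⁻ ω, ENNReal.ofReal (F n ω) ∂P ≤ ENNReal.ofReal (1 / (n : ℝ) ^ 2) := by
        intro n
        rw [← ofReal_integral_eq_lintegral_ofReal _ (ae_of_all _ fun ω => sq_nonneg _)]
        · exact ENNReal.ofReal_le_ofReal (hFi n)
        · simp only [div_pow]
          exact (hSsq _).div_const _
      refine ne_top_of_le_ne_top ?_ (ENNReal.tsum_le_tsum hle)
      exact (Real.summable_one_div_nat_pow.2 one_lt_two).tsum_ofReal_ne_top
    filter_upwards [ae_lt_top (Measurable.tsum fun n => (hFm n).ennreal_ofReal) hfin]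
      with ω hω
    have h0 := ENNReal.tendsto_atTop_zero_of_tsum_ne_top hω.ne
    have h1 := (ENNReal.tendsto_toReal ENNReal.zero_ne_top).comp h0
    have h2 : Tendsto (fun n => F n ω) atTop (nhds 0) := by
      refine h1.congr fun n => ?_
      exact ENNReal.toReal_ofReal (sq_nonneg _)
    have h3 := h2.sqrt
    simp only [hF, Real.sqrt_sq_eq_abs, Real.sqrt_zero] at h3
    exact (tendsto_zero_iff_abs_tendsto_zero _).2 h3
  filter_upwards [hsub] with ω hω
  refine tendsto_div_of_tendsto_sq_div (fun n => ?_) hω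
  simpa [hS, Finset.sum_range_succ] using hb n ω

theorem measurableSet_coord_eq {S : Type*} [MeasurableSpace S] [MeasurableSingletonClass S]
    (k : ℕ) (u : S) : MeasurableSet {ω : ℕ → S | ω k = u} :=
  (measurable_pi_apply k : Measurable fun ω : ℕ → S => ω k) (measurableSet_singleton u)

theorem measurableSet_cylinder_prefix {S : Type*} [MeasurableSpace S]
    [MeasurableSingletonClass S] (n : ℕ) (x : ℕ → S) :
    MeasurableSet {ω : ℕ → S | ∀ k ≤ n, ω k = x k} := by
  have : {ω : ℕ → S | ∀ k ≤ n, ω k = x k} = ⋂ k ∈ Set.Iic n, {ω | ω k = x k} := by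
    ext ω; simp
  rw [this]
  exact MeasurableSet.biInter (Set.to_countable _) fun k _ =>
    measurableSet_coord_eq k _

section MarkovChain

variable {S : Type*} [DecidableEq S]

/-- The deviation of the `k`-th transition of the trajectory `ω` from its conditional expectation:
the compensated indicator of a transition from `u` to `v` at time `k`. -/
noncomputable def transDev (q : S → S → ℝ) (u v : S) (k : ℕ) (ω : ℕ → S) : ℝ :=
  (if ω k = u then 1 else 0) * ((if ω (k + 1) = v then 1 else 0) - q u v)

theorem abs_transDev_le_one {q : S → S → ℝ} {u v : S} (h0 : 0 ≤ q u v) (h1 : q u v ≤ 1)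
    (k : ℕ) (ω : ℕ → S) : |transDev q u v k ω| ≤ 1 := by
  unfold transDev
  rw [abs_le]
  split_ifs <;> constructor <;> linarith

variable [MeasurableSpace S] [MeasurableSingletonClass S]

theorem measurable_transDev (q : S → S → ℝ) (u v : S) (k : ℕ) :
    Measurable (transDev q u v k) := by
  exact (Measurable.ite (measurableSet_coord_eq k u) measurable_const measurable_const).mul
    ((Measurable.ite (measurableSet_coord_eq (k + 1) v) measurable_const measurable_const).sub
      measurable_const)

variable {q : S → S → ℝ} {μ : S → ℝ} {P : Measure (ℕ → S)} [IsProbabilityMeasure P]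

theorem setIntegral_transDev_cylinder (hμ : ∀ u, 0 ≤ μ u) (hq : ∀ u v, 0 ≤ q u v)
    (hP : ∀ (n : ℕ) (x : ℕ → S), P {ω | ∀ k ≤ n, ω k = x k} =
      ENNReal.ofReal (μ (x 0) * ∏ k ∈ Finset.range n, q (x k) (x (k + 1))))
    (u v : S) (n : ℕ) (x : ℕ → S) :
    ∫ ω in {ω | ∀ k ≤ n, ω k = x k}, transDev q u v n ω ∂P = 0 := by
  have hreal : ∀ (n : ℕ) (x : ℕ → S), P.real {ω | ∀ k ≤ n, ω k = x k} =
      μ (x 0) * ∏ k ∈ Finset.range n, q (x k) (x (k + 1)) := fun n x => by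
    rw [Measure.real, hP,
      ENNReal.toReal_ofReal (mul_nonneg (hμ _) (Finset.prod_nonneg fun _ _ => hq _ _))]
  set C := {ω : ℕ → S | ∀ k ≤ n, ω k = x k} with hC
  have hCm : MeasurableSet C := measurableSet_cylinder_prefix n x
  have hVm : MeasurableSet {ω : ℕ → S | ω (n + 1) = v} :=
    measurableSet_coord_eq (n + 1) v
  have hstep : P.real ({ω | ω (n + 1) = v} ∩ C) = P.real C * q (x n) v := by
    have hset : {ω | ω (n + 1) = v} ∩ C =
        {ω | ∀ k ≤ n + 1, ω k = Function.update x (n + 1) v k} := by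
      ext ω
      simp only [hC, Set.mem_inter_iff, Set.mem_ofPred_eq]
      constructor
      · rintro ⟨h1, h2⟩ k hk
        rcases Nat.le_succ_iff.1 hk with h | rfl
        · rw [Function.update_of_ne (by omega)]; exact h2 k h
        · simpa using h1
      · intro h
        refine ⟨by simpa using h (n + 1) le_rfl, fun k hk => ?_⟩
        have := h k (by omega)
        rwa [Function.update_of_ne (by omega)] at this
    rw [hset, hreal, hreal, Finset.prod_range_succ, Function.update_of_ne (by omega),
      Function.update_self, Function.update_of_ne (by omega), ← mul_assoc]
    congr 2
    refine Finset.prod_congr rfl fun k hk => ?_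
    have := Finset.mem_range.1 hk
    rw [Function.update_of_ne (by omega), Function.update_of_ne (by omega)]
  have hcongr : ∀ ω ∈ C, transDev q u v n ω = (if x n = u then 1 else 0) *
      (Set.indicator {ω : ℕ → S | ω (n + 1) = v} 1 ω - q u v) := by
    intro ω hω
    simp [transDev, hω n le_rfl, Set.indicator_apply]
  rw [setIntegral_congr_fun hCm hcongr, integral_const_mul]
  split_ifs with hu
  · rw [integral_sub ((integrable_indicator_iff hVm).2 (integrable_const _).integrableOn)
      (integrable_const _), integral_indicator_one hVm, measureReal_restrict_apply hVm, hstep, hu]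
    simp
  · simp

variable [Finite S]

theorem integral_mul_transDev_eq_zero (hμ : ∀ u, 0 ≤ μ u) (hq : ∀ u v, 0 ≤ q u v)
    (hP : ∀ (n : ℕ) (x : ℕ → S), P {ω | ∀ k ≤ n, ω k = x k} =
      ENNReal.ofReal (μ (x 0) * ∏ k ∈ Finset.range n, q (x k) (x (k + 1))))
    (u v : S) (n : ℕ) {f : (ℕ → S) → ℝ}
    (hf : ∀ ω x : ℕ → S, (∀ k ≤ n, ω k = x k) → f ω = f x)
    (hinteg : Integrable (fun ω => f ω * transDev q u v n ω) P) :
    ∫ ω, f ω * transDev q u v n ω ∂P = 0 := by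
  have := Fintype.ofFinite S
  let ext : (Fin (n + 1) → S) → ℕ → S := fun y k => y (Fin.ofNat (n + 1) k)
  have hext : ∀ (y : Fin (n + 1) → S) (k : Fin (n + 1)), ext y k = y k := fun y k => by
    simp [ext]
  let C : (Fin (n + 1) → S) → Set (ℕ → S) := fun y => {ω | ∀ k ≤ n, ω k = ext y k}
  have hCm : ∀ y, MeasurableSet (C y) := fun y => measurableSet_cylinder_prefix n _
  have hdisj : Pairwise (Function.onFun Disjoint C) := by
    intro y z hyz
    refine Set.disjoint_left.2 fun ω h1 h2 => hyz ?_
    funext k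
    rw [← hext y, ← hext z, ← h1 k (by omega), h2 k (by omega)]
  have hcover : ⋃ y, C y = Set.univ := by
    refine Set.eq_univ_of_forall fun ω => Set.mem_iUnion.2 ⟨fun k => ω k, fun k hk => ?_⟩
    exact (hext (fun k => ω k) ⟨k, by omega⟩).symm
  rw [← setIntegral_univ, ← hcover,
    integral_iUnion_fintype hCm hdisj fun y => hinteg.integrableOn]
  refine Finset.sum_eq_zero fun y _ => ?_
  have hcongr : ∀ ω ∈ C y, f ω * transDev q u v n ω = f (ext y) * transDev q u v n ω :=
    fun ω hω => by rw [hf ω _ hω]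
  rw [setIntegral_congr_fun (hCm y) hcongr, integral_const_mul,
    setIntegral_transDev_cylinder hμ hq hP, mul_zero]

/-- The law of large numbers for the compensated transition counts of a finite Markov chain. -/
theorem ae_tendsto_sum_transDev_div (hμ : ∀ u, 0 ≤ μ u) (hq : ∀ u v, 0 ≤ q u v)
    (hq1 : ∀ u v, q u v ≤ 1)
    (hP : ∀ (n : ℕ) (x : ℕ → S), P {ω | ∀ k ≤ n, ω k = x k} =
      ENNReal.ofReal (μ (x 0) * ∏ k ∈ Finset.range n, q (x k) (x (k + 1)))) (u v : S) :
    ∀ᵐ ω ∂P, Tendsto (fun n : ℕ => (∑ k ∈ Finset.range n, transDev q u v k ω) / n)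
      atTop (nhds 0) := by
  have hb := abs_transDev_le_one (hq u v) (hq1 u v)
  have hm := measurable_transDev q u v
  refine ae_tendsto_sum_div_of_orthogonal P _ hm hb fun n => ?_
  refine integral_mul_transDev_eq_zero hμ hq hP u v n (fun ω x h => ?_) ?_
  · refine Finset.sum_congr rfl fun k hk => ?_
    have := Finset.mem_range.1 hk
    simp only [transDev, h k (by omega), h (k + 1) (by omega)]
  · refine Integrable.of_bound
      ((Finset.measurable_fun_sum _ fun k _ => hm k).mul (hm n)).aestronglyMeasurable (n * 1)
      (ae_of_all _ fun ω => ?_)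
    rw [Real.norm_eq_abs, abs_mul]
    gcongr
    · exact (Finset.abs_sum_le_sum_abs _ _).trans <|
        (Finset.sum_le_sum fun k _ => hb k ω).trans (by simp)
    · exact hb n ω

end MarkovChain

/-- Along a trajectory with vanishing compensated transition frequencies, a bounded log-likelihood
ratio `l T` whose sum over the first `T` transitions is nonpositive and whose conditional means
`∑ v, q u v * l T u v` are nonnegative must have conditional means tending to zero. -/
theorem tendsto_sum_condMean_zero {S : Type*} [DecidableEq S] [Fintype S]
    {q : S → S → ℝ} {c B : ℝ} (hc : 0 < c) (hB : 0 ≤ B) (hq : ∀ u v, c ≤ q u v)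
    (hq1 : ∀ u, ∑ v, q u v = 1) {l : ℕ → S → S → ℝ} (hl : ∀ T u v, |l T u v| ≤ B)
    (hl0 : ∀ T u, 0 ≤ ∑ v, q u v * l T u v) {ω : ℕ → S}
    (hsum : ∀ T, ∑ k ∈ Finset.range T, l T (ω k) (ω (k + 1)) ≤ 0)
    (hdev : ∀ u v, Tendsto (fun n : ℕ => (∑ k ∈ Finset.range n, transDev q u v k ω) / n)
      atTop (nhds 0)) :
    Tendsto (fun T => ∑ u, ∑ v, q u v * l T u v) atTop (nhds 0) := by
  set N : ℕ → S → ℝ := fun T u => ∑ k ∈ Finset.range T, if ω k = u then 1 else 0 with hN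
  set M : ℕ → S → S → ℝ := fun T u v => ∑ k ∈ Finset.range T,
    (if ω k = u then 1 else 0) * (if ω (k + 1) = v then 1 else 0) with hM
  set V : ℕ → S → S → ℝ := fun T u v => ∑ k ∈ Finset.range T, transDev q u v k ω with hV
  set E : ℕ → ℝ := fun T => ∑ u, ∑ v, |V T u v| with hE
  set H : ℕ → S → ℝ := fun T u => ∑ v, q u v * l T u v with hH
  set K : ℝ := Fintype.card S * B with hK
  have hK0 : 0 ≤ K := by positivity
  have hq0 : ∀ u v, 0 ≤ q u v := fun u v => hc.le.trans (hq u v)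
  have hN0 : ∀ T u, 0 ≤ N T u := fun T u => Finset.sum_nonneg fun k _ => by split_ifs <;> simp
  have hVM : ∀ T u v, V T u v = M T u v - q u v * N T u := fun T u v => by
    simp only [hV, hM, hN, transDev, mul_sub, Finset.sum_sub_distrib, Finset.mul_sum]
    congr 1
    exact Finset.sum_congr rfl fun k _ => mul_comm _ _
  have hE0 : ∀ T, 0 ≤ E T := fun T =>
    Finset.sum_nonneg fun u _ => Finset.sum_nonneg fun v _ => abs_nonneg _
  have hML : ∀ T, ∑ k ∈ Finset.range T, l T (ω k) (ω (k + 1)) =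
      ∑ u, ∑ v, M T u v * l T u v := fun T => by
    simp only [hM, Finset.sum_mul]
    simp_rw [Finset.sum_comm (s := (Finset.univ : Finset S)) (t := Finset.range T)]
    refine Finset.sum_congr rfl fun k _ => ?_
    simp
  have hNH : ∀ T, ∑ u, N T u * H T u ≤ B * E T := fun T => by
    have h1 : ∑ u, N T u * H T u = ∑ u, ∑ v, M T u v * l T u v - ∑ u, ∑ v, V T u v * l T u v := by
      simp only [← Finset.sum_sub_distrib, hH, Finset.mul_sum]
      refine Finset.sum_congr rfl fun u _ => Finset.sum_congr rfl fun v _ => ?_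
      rw [hVM]; ring
    have h2 : -∑ u, ∑ v, V T u v * l T u v ≤ B * E T := by
      simp only [hE, Finset.mul_sum, ← Finset.sum_neg_distrib]
      refine Finset.sum_le_sum fun u _ => Finset.sum_le_sum fun v _ => ?_
      calc -(V T u v * l T u v) ≤ |V T u v * l T u v| := neg_le_abs _
        _ = |l T u v| * |V T u v| := by rw [abs_mul, mul_comm]
        _ ≤ B * |V T u v| := by gcongr; exact hl T u v
    have h3 := hsum T
    rw [hML] at h3
    linarith
  have hNsum : ∀ T, ∑ u, N T u = T := fun T => by
    simp only [hN]
    rw [Finset.sum_comm]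
    simp
  have hNlow : ∀ T v, c * T - 1 - E T ≤ N T v := fun T v => by
    have h1 : ∑ u, M T u v ≤ N T v + 1 := by
      have e : ∑ u, M T u v = ∑ k ∈ Finset.range T, if ω (k + 1) = v then (1 : ℝ) else 0 := by
        simp only [hM]
        rw [Finset.sum_comm]
        simp
      have h := Finset.sum_range_succ (fun k => if ω k = v then (1 : ℝ) else 0) T
      rw [Finset.sum_range_succ'] at h
      have ha : (if ω T = v then (1 : ℝ) else 0) ≤ 1 := by split_ifs <;> simp
      have hb : (0 : ℝ) ≤ if ω 0 = v then (1 : ℝ) else 0 := by split_ifs <;> simp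
      rw [e]
      simp only [hN]
      linarith
    have h2 : ∑ u, M T u v = ∑ u, V T u v + ∑ u, q u v * N T u := by
      rw [← Finset.sum_add_distrib]
      exact Finset.sum_congr rfl fun u _ => by rw [hVM]; ring
    have h3 : c * T ≤ ∑ u, q u v * N T u := by
      rw [← hNsum, Finset.mul_sum]
      exact Finset.sum_le_sum fun u _ => mul_le_mul_of_nonneg_right (hq u v) (hN0 T u)
    have h4 : -∑ u, V T u v ≤ E T := by
      rw [← Finset.sum_neg_distrib]
      refine Finset.sum_le_sum fun u _ => (neg_le_abs _).trans ?_
      exact Finset.single_le_sum (f := fun v => |V T u v|) (fun _ _ => abs_nonneg _)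
        (Finset.mem_univ v)
    linarith
  have hHK : ∀ T, ∑ u, H T u ≤ K := fun T => by
    have : ∀ u, H T u ≤ B := fun u => by
      calc H T u ≤ ∑ v, q u v * B := Finset.sum_le_sum fun v _ =>
            mul_le_mul_of_nonneg_left ((le_abs_self _).trans (hl T u v)) (hq0 u v)
        _ = B := by rw [← Finset.sum_mul, hq1, one_mul]
    exact (Finset.sum_le_sum fun u _ => this u).trans (by simp [hK])
  have hmain : ∀ T : ℕ, c * T * ∑ u, H T u ≤ B * E T + (1 + E T) * K := fun T => by
    have h1 : (c * T - 1 - E T) * ∑ u, H T u ≤ ∑ u, N T u * H T u := by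
      rw [Finset.mul_sum]
      exact Finset.sum_le_sum fun u _ => mul_le_mul_of_nonneg_right (hNlow T u) (hl0 T u)
    have h2 : (1 + E T) * ∑ u, H T u ≤ (1 + E T) * K :=
      mul_le_mul_of_nonneg_left (hHK T) (by linarith [hE0 T])
    linarith [hNH T]
  have hElim : Tendsto (fun T : ℕ => E T / T) atTop (nhds 0) := by
    have : Tendsto (fun T : ℕ => ∑ u, ∑ v, |V T u v / T|) atTop
        (nhds (∑ _u : S, ∑ _v : S, |(0:ℝ)|)) :=
      tendsto_finsetSum _ fun u _ => tendsto_finsetSum _ fun v _ => (hdev u v).abs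
    simpa [hE, Finset.sum_div, abs_div] using this
  have hlim : Tendsto (fun T : ℕ => (B * (E T / T) + ((T : ℝ)⁻¹ + E T / T) * K) / c)
      atTop (nhds 0) := by
    simpa using ((hElim.const_mul B).add
      (((tendsto_inv_atTop_nhds_zero_nat (𝕜 := ℝ)).add hElim).mul_const K)).div_const c
  refine squeeze_zero' (Eventually.of_forall fun T => Finset.sum_nonneg fun u _ => hl0 T u) ?_ hlim
  filter_upwards [eventually_gt_atTop 0] with T hT
  have hT' : (0 : ℝ) < T := by exact_mod_cast hT
  have e : (B * (E T / T) + ((T : ℝ)⁻¹ + E T / T) * K) / c =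
      (B * E T + (1 + E T) * K) / (c * T) := by field_simp
  rw [e, le_div_iff₀ (by positivity), mul_comm]
  exact hmain T

theorem sub_le_mul_log_sub_log {q p : ℝ} (hq : 0 < q) (hp : 0 < p) :
    q - p ≤ q * (Real.log q - Real.log p) := by
  have h := Real.log_le_sub_one_of_pos (div_pos hp hq)
  rw [Real.log_div hp.ne' hq.ne'] at h
  have h2 := mul_le_mul_of_nonneg_left h hq.le
  have e : q * (p / q - 1) = p - q := by field_simp
  linarith

theorem eq_of_mul_log_sub_log_eq {q p : ℝ} (hq : 0 < q) (hp : 0 < p)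
    (h : q * (Real.log q - Real.log p) = q - p) : p = q := by
  by_contra hne
  have h1 := Real.log_lt_sub_one_of_pos (div_pos hp hq) fun e => hne ((div_eq_one_iff_eq hq.ne').1 e)
  rw [Real.log_div hp.ne' hq.ne'] at h1
  have h2 := mul_lt_mul_of_pos_left h1 hq
  have e : q * (p / q - 1) = p - q := by field_simp
  linarith

section RelativeEntropy

variable {S : Type*} [Fintype S] {q p : S → ℝ}

theorem sum_mul_log_sub_log_nonneg (hq : ∀ v, 0 < q v) (hp : ∀ v, 0 < p v)
    (hsum : ∑ v, q v = ∑ v, p v) : 0 ≤ ∑ v, q v * (Real.log (q v) - Real.log (p v)) := by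
  have := Finset.sum_le_sum fun v (_ : v ∈ Finset.univ) => sub_le_mul_log_sub_log (hq v) (hp v)
  rwa [Finset.sum_sub_distrib, hsum, sub_self] at this

theorem eq_of_sum_mul_log_sub_log_eq_zero (hq : ∀ v, 0 < q v) (hp : ∀ v, 0 < p v)
    (hsum : ∑ v, q v = ∑ v, p v) (h : ∑ v, q v * (Real.log (q v) - Real.log (p v)) = 0) (v : S) :
    p v = q v := by
  have h0 : ∑ v, (q v - p v) = ∑ v, q v * (Real.log (q v) - Real.log (p v)) := by
    rw [Finset.sum_sub_distrib, hsum, sub_self, h]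
  have := (Finset.sum_eq_sum_iff_of_le fun v _ => sub_le_mul_log_sub_log (hq v) (hp v)).1 h0 v
    (Finset.mem_univ v)
  exact eq_of_mul_log_sub_log_eq (hq v) (hp v) this.symm

end RelativeEntropy

section Model

variable {p : ℕ}

theorem sum_gBarTrans (θ : GParam p) (u : State p) : ∑ v, gBarTrans θ u v = 1 := by
  unfold gBarTrans
  rw [← Fintype.prod_sum fun (i : Fin p) (c : Bool) => if c then gBern θ u i else 1 - gBern θ u i]
  simp

theorem continuous_gBern (u : State p) (i : Fin p) :
    Continuous fun θ : GParam p => gBern θ u i := by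
  unfold gBern
  fun_prop

theorem continuous_gBarTrans (u v : State p) :
    Continuous fun θ : GParam p => gBarTrans θ u v := by
  unfold gBarTrans
  refine continuous_finsetProd _ fun i _ => ?_
  have := continuous_gBern u i
  split_ifs
  · exact this
  · exact continuous_const.sub this

variable {bmin ρmin ρmax : ℝ} {θ : GParam p}

theorem stR_mem_Icc (u : State p) (j : Fin p) : stR u j ∈ Set.Icc (0 : ℝ) 1 := by
  unfold stR
  split_ifs <;> simp

theorem gBern_mem_Icc (hbmin : 0 ≤ bmin) (hρmin : 0 ≤ ρmin) (hρmax : ρmax ≤ 1)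
    (hθ : θ ∈ gBarSpace p bmin ρmin ρmax) (u : State p) (i : Fin p) :
    gBern θ u i ∈ Set.Icc (bmin * ρmin) (1 - bmin * (1 - ρmax)) := by
  obtain ⟨ha, ha', -, hsum, hb, hr⟩ := hθ
  have h1 : 0 ≤ ∑ j, θ.1 i j * stR u j :=
    Finset.sum_nonneg fun j _ => mul_nonneg (ha i j) (stR_mem_Icc u j).1
  have h2 : 0 ≤ ∑ j, θ.2.1 i j * (1 - stR u j) :=
    Finset.sum_nonneg fun j _ => mul_nonneg (ha' i j) (sub_nonneg.2 (stR_mem_Icc u j).2)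
  have h3 : (∑ j, θ.1 i j * stR u j) + (∑ j, θ.2.1 i j * (1 - stR u j)) ≤
      ∑ j, (θ.1 i j + θ.2.1 i j) := by
    rw [← Finset.sum_add_distrib]
    refine Finset.sum_le_sum fun j _ => ?_
    have := stR_mem_Icc u j
    nlinarith [mul_nonneg (ha i j) (sub_nonneg.2 this.2), mul_nonneg (ha' i j) this.1]
  have h4 : bmin * ρmin ≤ θ.2.2.1 i * θ.2.2.2 i :=
    mul_le_mul (hb i) (hr i).1 hρmin (hbmin.trans (hb i))
  have h5 : bmin * (1 - ρmax) ≤ θ.2.2.1 i * (1 - θ.2.2.2 i) :=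
    mul_le_mul (hb i) (by linarith [(hr i).2]) (by linarith) (hbmin.trans (hb i))
  have h6 := hsum i
  unfold gBern
  constructor <;> linarith

theorem pow_le_gBarTrans (hbmin : 0 ≤ bmin) (hρmin : 0 ≤ ρmin) (hρmax : ρmax ≤ 1)
    (hθ : θ ∈ gBarSpace p bmin ρmin ρmax) (u v : State p) :
    (bmin * min ρmin (1 - ρmax)) ^ p ≤ gBarTrans θ u v := by
  have h0 : 0 ≤ bmin * min ρmin (1 - ρmax) := mul_nonneg hbmin (le_min hρmin (by linarith))
  have h1 : bmin * min ρmin (1 - ρmax) ≤ bmin * ρmin :=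
    mul_le_mul_of_nonneg_left (min_le_left _ _) hbmin
  have h2 : bmin * min ρmin (1 - ρmax) ≤ bmin * (1 - ρmax) :=
    mul_le_mul_of_nonneg_left (min_le_right _ _) hbmin
  unfold gBarTrans
  calc _ = ∏ _i : Fin p, bmin * min ρmin (1 - ρmax) := by simp
    _ ≤ _ := Finset.prod_le_prod (fun _ _ => h0) fun i _ => by
      have := gBern_mem_Icc hbmin hρmin hρmax hθ u i
      split_ifs <;> linarith [this.1, this.2]

/-- A product of nondegenerate Bernoulli laws determines its parameters. -/
theorem gBern_eq_of_gBarTrans_eq {θ' : GParam p} {u : State p}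
    (hpos : ∀ v, 0 < gBarTrans θ u v) (h : ∀ v, gBarTrans θ u v = gBarTrans θ' u v) (i : Fin p) :
    gBern θ u i = gBern θ' u i := by
  have key : ∀ (η : GParam p) (c : Bool), gBarTrans η u (Function.update (fun _ => true) i c) =
      (if c then gBern η u i else 1 - gBern η u i) * ∏ j ∈ Finset.univ.erase i, gBern η u j := by
    intro η c
    unfold gBarTrans
    rw [← Finset.mul_prod_erase _ _ (Finset.mem_univ i), Function.update_self]
    congr 1
    refine Finset.prod_congr rfl fun j hj => ?_
    rw [Function.update_of_ne (Finset.ne_of_mem_erase hj), if_pos rfl]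
  have ht := h (Function.update (fun _ => true) i true)
  have hf := h (Function.update (fun _ => true) i false)
  have hp1 := hpos (Function.update (fun _ => true) i true)
  have hp2 := hpos (Function.update (fun _ => true) i false)
  simp only [key, if_true, Bool.false_eq_true, if_false] at ht hf hp1 hp2
  have hR : ∏ j ∈ Finset.univ.erase i, gBern θ u j = ∏ j ∈ Finset.univ.erase i, gBern θ' u j := by
    linarith
  rw [← hR] at ht
  refine mul_right_cancel₀ ?_ ht
  intro h0
  rw [h0] at hp1
  simp at hp1

/-- Disjointly supported nonnegative numbers are determined by their difference. -/
theorem eq_and_eq_of_sub_eq_sub {a b c d : ℝ} (ha : 0 ≤ a) (hb : 0 ≤ b) (hc : 0 ≤ c) (hd : 0 ≤ d)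
    (hab : a * b = 0) (hcd : c * d = 0) (h : a - b = c - d) : a = c ∧ b = d := by
  rcases mul_eq_zero.1 hab with rfl | rfl <;> rcases mul_eq_zero.1 hcd with rfl | rfl <;>
    constructor <;> linarith

/-- Identifiability of the parameters from the conditional Bernoulli means. -/
theorem eq_of_gBern_eq {θ' : GParam p} (hbmin : 0 < bmin)
    (hθ : θ ∈ gBarSpace p bmin ρmin ρmax) (hθ' : θ' ∈ gBarSpace p bmin ρmin ρmax)
    (h : ∀ u i, gBern θ u i = gBern θ' u i) : θ = θ' := by
  obtain ⟨ha, hã, haã, hsum, hb, -⟩ := hθ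
  obtain ⟨ha', hã', haã', hsum', -, -⟩ := hθ'
  have hzero : ∀ (η : GParam p) (i : Fin p), gBern η (fun _ => false) i =
      (∑ j, η.2.1 i j) + η.2.2.1 i * η.2.2.2 i := fun η i => by simp [gBern, stR]
  have hsingle : ∀ (η : GParam p) (i j : Fin p), gBern η (fun k => decide (k = j)) i =
      gBern η (fun _ => false) i + (η.1 i j - η.2.1 i j) := fun η i j => by
    simp [gBern, stR, mul_sub, Finset.sum_sub_distrib]
    ring
  have hentry : ∀ i j, θ.1 i j = θ'.1 i j ∧ θ.2.1 i j = θ'.2.1 i j := fun i j => by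
    refine eq_and_eq_of_sub_eq_sub (ha i j) (hã i j) (ha' i j) (hã' i j) (haã i j) (haã' i j) ?_
    have h1 := h (fun k => decide (k = j)) i
    rw [hsingle, hsingle, h] at h1
    linarith
  have hbeq : ∀ i, θ.2.2.1 i = θ'.2.2.1 i := fun i => by
    have h1 := hsum i
    have h2 := hsum' i
    simp only [(hentry i _).1, (hentry i _).2] at h1
    linarith
  have hρeq : ∀ i, θ.2.2.2 i = θ'.2.2.2 i := fun i => by
    have h1 := h (fun _ => false) i
    rw [hzero, hzero] at h1
    simp only [(hentry i _).2, ← hbeq] at h1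
    exact mul_left_cancel₀ (hbmin.trans_le (hb i)).ne' (add_left_cancel h1)
  refine Prod.ext (Matrix.ext fun i j => (hentry i j).1) (Prod.ext (Matrix.ext fun i j =>
    (hentry i j).2) (Prod.ext (funext hbeq) (funext hρeq)))

theorem isClosed_gBarSpace : IsClosed (gBarSpace p bmin ρmin ρmax) := by
  have h : gBarSpace p bmin ρmin ρmax =
      (⋂ i, ⋂ j, {θ : GParam p | 0 ≤ θ.1 i j}) ∩ ((⋂ i, ⋂ j, {θ | 0 ≤ θ.2.1 i j}) ∩
      ((⋂ i, ⋂ j, {θ | θ.1 i j * θ.2.1 i j = 0}) ∩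
      ((⋂ i, {θ | (∑ j, (θ.1 i j + θ.2.1 i j)) + θ.2.2.1 i = 1}) ∩
      ((⋂ i, {θ | bmin ≤ θ.2.2.1 i}) ∩ ⋂ i, {θ | θ.2.2.2 i ∈ Set.Icc ρmin ρmax})))) := by
    ext θ
    simp only [gBarSpace, Set.mem_inter_iff, Set.mem_iInter, Set.mem_ofPred_eq]
  rw [h]
  refine (isClosed_iInter fun i => isClosed_iInter fun j => ?_).inter <|
    (isClosed_iInter fun i => isClosed_iInter fun j => ?_).inter <|
    (isClosed_iInter fun i => isClosed_iInter fun j => ?_).inter <|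
    (isClosed_iInter fun i => ?_).inter <|
    (isClosed_iInter fun i => ?_).inter (isClosed_iInter fun i => ?_)
  · exact isClosed_le (by fun_prop) (by fun_prop)
  · exact isClosed_le (by fun_prop) (by fun_prop)
  · exact isClosed_eq (by fun_prop) (by fun_prop)
  · exact isClosed_eq (by fun_prop) (by fun_prop)
  · exact isClosed_le (by fun_prop) (by fun_prop)
  · exact isClosed_Icc.preimage (by fun_prop)

theorem isCompact_gBarSpace (hbmin : 0 ≤ bmin) : IsCompact (gBarSpace p bmin ρmin ρmax) := by
  have hpi : IsCompact {A : Fin p → Fin p → ℝ | ∀ i j, A i j ∈ Set.Icc (0 : ℝ) 1} := by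
    have hset : {A : Fin p → Fin p → ℝ | ∀ i j, A i j ∈ Set.Icc (0 : ℝ) 1} =
        Set.univ.pi fun _ => Set.univ.pi fun _ => Set.Icc 0 1 := by
      ext A
      simp only [Set.mem_univ_pi, Set.mem_ofPred_eq]
    rw [hset]
    exact isCompact_univ_pi fun _ => isCompact_univ_pi fun _ => isCompact_Icc
  have hmat : IsCompact {A : Matrix (Fin p) (Fin p) ℝ | ∀ i j, A i j ∈ Set.Icc (0 : ℝ) 1} := hpi
  have hvec : ∀ r s : ℝ, IsCompact (Set.univ.pi fun _ : Fin p => Set.Icc r s) := fun r s =>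
    isCompact_univ_pi fun _ => isCompact_Icc
  refine (hmat.prod (hmat.prod ((hvec 0 1).prod (hvec ρmin ρmax)))).of_isClosed_subset
    isClosed_gBarSpace ?_
  rintro θ ⟨ha, hã, -, hsum, hb, hr⟩
  have hb0 : ∀ i, 0 ≤ θ.2.2.1 i := fun i => hbmin.trans (hb i)
  have hle : ∀ i j, θ.1 i j + θ.2.1 i j ≤ 1 := fun i j => by
    have := Finset.single_le_sum (f := fun j => θ.1 i j + θ.2.1 i j)
      (fun j _ => add_nonneg (ha i j) (hã i j)) (Finset.mem_univ j)
    linarith [hsum i, hb0 i]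
  have hsum0 : ∀ i, 0 ≤ ∑ j, (θ.1 i j + θ.2.1 i j) := fun i =>
    Finset.sum_nonneg fun j _ => add_nonneg (ha i j) (hã i j)
  exact ⟨fun i j => ⟨ha i j, by linarith [hle i j, hã i j]⟩,
    fun i j => ⟨hã i j, by linarith [hle i j, ha i j]⟩,
    fun i _ => ⟨hb0 i, by linarith [hsum i, hsum0 i]⟩, fun i _ => hr i⟩

end Model

/-- **Strong consistency of the ML estimator for the generic BAR model.**
If `θ0 ∈ Θ̃`, `μ` is any initial distribution on `{0,1}^p`, and `θhat T ω` is, for each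
horizon `T` and trajectory `ω`, a maximizer over `Θ̃` of the log-likelihood
`θ̃ ↦ ∑_{k=0}^{T−1} log p_{X(k)X(k+1)}(θ̃)`, then `θhat T → θ0` almost surely
under `P_{θ0,μ}`. -/
theorem generic_mle_strong_consistency
    (p : ℕ) (hp : 1 ≤ p) (bmin ρmin ρmax : ℝ)
    (hbmin : bmin ∈ Set.Ioo (0 : ℝ) 1)
    (hρmin : 0 < ρmin) (hρ : ρmin ≤ ρmax) (hρmax : ρmax < 1)
    (θ0 : GParam p) (hθ0 : θ0 ∈ gBarSpace p bmin ρmin ρmax)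
    (μ : State p → ℝ) (hμ0 : ∀ u, 0 ≤ μ u) (hμ1 : ∑ u, μ u = 1)
    (P : Measure (ℕ → State p)) (hPprob : IsProbabilityMeasure P)
    (hPlaw : IsGBARLaw θ0 μ P)
    (θhat : ℕ → (ℕ → State p) → GParam p)
    (hmem : ∀ T ω, θhat T ω ∈ gBarSpace p bmin ρmin ρmax)
    (hmax : ∀ T ω, ∀ θ ∈ gBarSpace p bmin ρmin ρmax,
      gLogLik θ T ω ≤ gLogLik (θhat T ω) T ω) :
    ∀ᵐ ω ∂P, Tendsto (fun T => θhat T ω) atTop (nhds θ0) := by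
  set c : ℝ := (bmin * min ρmin (1 - ρmax)) ^ p with hc
  have hc0 : 0 < c := pow_pos (mul_pos hbmin.1 (lt_min hρmin (by linarith))) p
  have hlow : ∀ θ ∈ gBarSpace p bmin ρmin ρmax, ∀ u v, c ≤ gBarTrans θ u v := fun θ hθ u v =>
    pow_le_gBarTrans hbmin.1.le hρmin.le hρmax.le hθ u v
  have hpos : ∀ θ ∈ gBarSpace p bmin ρmin ρmax, ∀ u v, 0 < gBarTrans θ u v := fun θ hθ u v =>
    hc0.trans_le (hlow θ hθ u v)
  have hle1 : ∀ θ ∈ gBarSpace p bmin ρmin ρmax, ∀ u v, gBarTrans θ u v ≤ 1 := fun θ hθ u v => by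
    rw [← sum_gBarTrans θ u]
    exact Finset.single_le_sum (fun v _ => (hpos θ hθ u v).le) (Finset.mem_univ v)
  have hlog : ∀ θ ∈ gBarSpace p bmin ρmin ρmax, ∀ u v,
      Real.log (gBarTrans θ u v) ∈ Set.Icc (Real.log c) 0 := fun θ hθ u v =>
    ⟨Real.log_le_log hc0 (hlow θ hθ u v), Real.log_nonpos (hpos θ hθ u v).le (hle1 θ hθ u v)⟩
  have hsums : ∀ θ u, ∑ v, gBarTrans θ0 u v = ∑ v, gBarTrans θ u v := fun θ u => by
    rw [sum_gBarTrans, sum_gBarTrans]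
  have hlln := ae_all_iff.2 fun u => ae_all_iff.2 fun v =>
    ae_tendsto_sum_transDev_div hμ0 (fun u v => (hpos θ0 hθ0 u v).le) (hle1 θ0 hθ0) hPlaw u v
  filter_upwards [hlln] with ω hω
  have hlogc : Real.log c ≤ 0 :=
    (hlog θ0 hθ0 (fun _ => true) (fun _ => true)).1.trans (hlog θ0 hθ0 _ _).2
  have hent := tendsto_sum_condMean_zero hc0 (neg_nonneg.2 hlogc) (hlow θ0 hθ0) (sum_gBarTrans θ0)
    (l := fun T u v => Real.log (gBarTrans θ0 u v) - Real.log (gBarTrans (θhat T ω) u v))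
    (fun T u v => by
      have h1 := hlog θ0 hθ0 u v
      have h2 := hlog _ (hmem T ω) u v
      exact abs_le.2 ⟨by linarith [h1.1, h2.2], by linarith [h1.2, h2.1]⟩)
    (fun T u => sum_mul_log_sub_log_nonneg (hpos θ0 hθ0 u) (hpos _ (hmem T ω) u) (hsums _ u))
    (fun T => by
      rw [Finset.sum_sub_distrib]
      exact sub_nonpos.2 (hmax T ω θ0 hθ0))
    hω
  refine (isCompact_gBarSpace hbmin.1.le).tendsto_nhds_of_unique_mapClusterPt
    (Eventually.of_forall fun T => hmem T ω) fun θ hθ hcl => ?_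
  have hcont : ContinuousAt (fun η : GParam p => ∑ u, ∑ v, gBarTrans θ0 u v *
      (Real.log (gBarTrans θ0 u v) - Real.log (gBarTrans η u v))) θ :=
    tendsto_finsetSum _ fun u _ => tendsto_finsetSum _ fun v _ =>
      (tendsto_const_nhds.sub ((continuous_gBarTrans u v).continuousAt.log
        (hpos θ hθ u v).ne')).const_mul _
  have hzero := eq_of_nhds_neBot ((hcl.continuousAt_comp hcont).clusterPt.mono hent)
  have hu : ∀ u, ∑ v, gBarTrans θ0 u v *
      (Real.log (gBarTrans θ0 u v) - Real.log (gBarTrans θ u v)) = 0 := fun u =>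
    (Finset.sum_eq_zero_iff_of_nonneg fun u _ =>
      sum_mul_log_sub_log_nonneg (hpos θ0 hθ0 u) (hpos θ hθ u) (hsums θ u)).1 hzero u
      (Finset.mem_univ u)
  refine eq_of_gBern_eq hbmin.1 hθ hθ0 fun u i => ?_
  exact gBern_eq_of_gBarTrans_eq (hpos θ hθ u)
    (eq_of_sum_mul_log_sub_log_eq_zero (hpos θ0 hθ0 u) (hpos θ hθ u) (hsums θ u) (hu u)) i
end
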